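/- Let H be a cocommutative k-Hopf algebra and R a commutative k-algebra that is a left H-module algebra. Then the smash product R # H := R ⊗_k H, with multiplication (r#h)(s#k) = Σ r(h₍₁₎·s) # h₍₂₎k, unit 1#1, R-coalgebra structure induced by I_R ⊗ Δ_H under the identification R⊗H⊗H ≅ (R⊗H)⊗_R(R⊗H), and counit ε(r#h) = rε_H(h), is an R/k-bialgebra. -/

import Mathlib

open TensorProduct

namespace SmashAux

variable {k R H : Type} [Field k] [CommRing R] [Algebra k R] [Ring H] [HopfAlgebra k H]

/-- `a ⊗ b ↦ r (a·s) ⊗ b g`. -/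
noncomputable def core (act : H →ₗ[k] R →ₗ[k] R) (r s : R) (g : H) : H ⊗[k] H →ₗ[k] R ⊗[k] H :=
  TensorProduct.map (LinearMap.mulLeft k r ∘ₗ act.flip s) (LinearMap.mulRight k g)

@[simp] lemma core_tmul (act : H →ₗ[k] R →ₗ[k] R) (r s : R) (g a b : H) :
    core act r s g (a ⊗ₜ b) = (r * act a s) ⊗ₜ (b * g) := rfl

/-- The smash multiplication. -/
noncomputable def mul (act : H →ₗ[k] R →ₗ[k] R) :
    (R ⊗[k] H) →ₗ[k] (R ⊗[k] H) →ₗ[k] (R ⊗[k] H) :=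
  TensorProduct.lift (LinearMap.mk₂ k (fun r h => TensorProduct.lift (LinearMap.mk₂ k
      (fun s g => core act r s g (Coalgebra.comul h))
      (fun s s' g => by
        induction Coalgebra.comul (R := k) h using TensorProduct.induction_on with
        | zero => simp
        | tmul a b => simp [mul_add, add_tmul]
        | add x y hx hy => simp only [map_add, hx, hy]; abel)
      (fun c s g => by
        induction Coalgebra.comul (R := k) h using TensorProduct.induction_on with
        | zero => simp
        | tmul a b => simp [smul_tmul']
        | add x y hx hy => simp only [map_add, hx, hy, smul_add])
      (fun s g g' => by
        induction Coalgebra.comul (R := k) h using TensorProduct.induction_on with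
        | zero => simp
        | tmul a b => simp [mul_add, tmul_add]
        | add x y hx hy => simp only [map_add, hx, hy]; abel)
      (fun c s g => by
        induction Coalgebra.comul (R := k) h using TensorProduct.induction_on with
        | zero => simp
        | tmul a b => simp
        | add x y hx hy => simp only [map_add, hx, hy, smul_add])))
    (fun r r' h => by
      ext s g
      simp only [AlgebraTensorModule.curry_apply, curry_apply, LinearMap.coe_restrictScalars,
        lift.tmul, LinearMap.mk₂_apply, LinearMap.add_apply, LinearMap.restrictScalars_self]
      induction Coalgebra.comul (R := k) h using TensorProduct.induction_on with
        | zero => simp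
        | tmul a b => simp [add_mul, add_tmul]
        | add x y hx hy => simp only [map_add, hx, hy]; abel)
    (fun c r h => by
      ext s g
      simp only [AlgebraTensorModule.curry_apply, curry_apply, LinearMap.coe_restrictScalars,
        lift.tmul, LinearMap.mk₂_apply, LinearMap.smul_apply, LinearMap.restrictScalars_self]
      induction Coalgebra.comul (R := k) h using TensorProduct.induction_on with
        | zero => simp
        | tmul a b => simp [smul_tmul']
        | add x y hx hy => simp only [map_add, hx, hy, smul_add])
    (fun r h h' => by ext s g; simp)
    (fun c r h => by ext s g; simp))

lemma mul_tmul (act : H →ₗ[k] R →ₗ[k] R) (r s : R) (h g : H) :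
    mul act (r ⊗ₜ h) (s ⊗ₜ g) = core act r s g (Coalgebra.comul h) := rfl

lemma mul_smul_left (act : H →ₗ[k] R →ₗ[k] R) (t : R) (x y : R ⊗[k] H) :
    mul act (t • x) y = t • mul act x y := by
  induction x using TensorProduct.induction_on with
  | zero => simp
  | add x x' hx hy => simp only [smul_add, map_add, LinearMap.add_apply, hx, hy]
  | tmul r h =>
    induction y using TensorProduct.induction_on with
    | zero => simp
    | add x x' hx hy => simp only [smul_add, map_add, hx, hy]
    | tmul s g =>
      rw [smul_tmul', mul_tmul, mul_tmul]
      induction Coalgebra.comul (R := k) h using TensorProduct.induction_on with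
      | zero => simp
      | tmul a b => simp [smul_tmul', mul_assoc]
      | add x y hx hy => simp only [map_add, hx, hy, smul_add]

/-- Right multiplication, as an `R`-linear map. -/
noncomputable def mulR (act : H →ₗ[k] R →ₗ[k] R) (y : R ⊗[k] H) : (R ⊗[k] H) →ₗ[R] (R ⊗[k] H) where
  toFun x := mul act x y
  map_add' := by simp
  map_smul' t x := mul_smul_left act t x y

@[simp] lemma mulR_apply (act : H →ₗ[k] R →ₗ[k] R) (x y : R ⊗[k] H) :
    mulR act y x = mul act x y := rfl

lemma exists_fin (z : H ⊗[k] H) : ∃ (n : ℕ) (a b : Fin n → H), z = ∑ i, a i ⊗ₜ[k] b i := by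
  obtain ⟨s, hs⟩ := TensorProduct.exists_finset z
  refine ⟨s.card, fun i => (s.equivFin.symm i).1.1, fun i => (s.equivFin.symm i).1.2, ?_⟩
  rw [hs, ← Finset.sum_coe_sort]
  exact (Equiv.sum_comp s.equivFin.symm (fun i : s => i.1.1 ⊗ₜ[k] i.1.2)).symm

/-- A trilinear function as a linear map on the triple tensor product. -/
lemma exists_lin {M : Type*} [AddCommGroup M] [Module k M] (f : H → H → H → M)
    (h1 : ∀ b c, IsLinearMap k (fun a => f a b c)) (h2 : ∀ a c, IsLinearMap k (fun b => f a b c))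
    (h3 : ∀ a b, IsLinearMap k (fun c => f a b c)) :
    ∃ F : H ⊗[k] (H ⊗[k] H) →ₗ[k] M, ∀ a b c, F (a ⊗ₜ (b ⊗ₜ c)) = f a b c := by
  let G : H →ₗ[k] H →ₗ[k] H →ₗ[k] M := LinearMap.mk₂ k (fun a b => (h3 a b).mk' _)
    (fun a a' b => by ext c; exact (h1 b c).map_add a a')
    (fun t a b => by ext c; exact (h1 b c).map_smul t a)
    (fun a b b' => by ext c; exact (h2 a c).map_add b b')
    (fun t a b => by ext c; exact (h2 a c).map_smul t b)
  exact ⟨TensorProduct.lift (TensorProduct.lift.equiv (.id k) H H M ∘ₗ G), fun a b c => rfl⟩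

lemma coassoc3 {n : H → ℕ} {a b : ∀ h : H, Fin (n h) → H}
    (hab : ∀ h : H, Coalgebra.comul (R := k) h = ∑ i, a h i ⊗ₜ[k] b h i)
    {M : Type*} [AddCommGroup M] [Module k M] (f : H → H → H → M)
    (h1 : ∀ b c, IsLinearMap k (fun a => f a b c)) (h2 : ∀ a c, IsLinearMap k (fun b => f a b c))
    (h3 : ∀ a b, IsLinearMap k (fun c => f a b c)) (h : H) :
    ∑ i, ∑ j, f (a (a h i) j) (b (a h i) j) (b h i) =
      ∑ i, ∑ j, f (a h i) (a (b h i) j) (b (b h i) j) := by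
  obtain ⟨F, hF⟩ := exists_lin f h1 h2 h3
  have := congrArg F (Coalgebra.coassoc_apply (R := k) h)
  rw [hab h] at this
  simpa [hab (a h _), hab (b h _), sum_tmul, tmul_sum, hF] using this

end SmashAux

/-- **Proposition (Nichols–Weisfeiler).** Let `H` be a cocommutative `k`-Hopf algebra and
`R` a commutative `k`-algebra which is a left `H`-module algebra (via `act`).  Then the
smash product `R # H := R ⊗[k] H`, with multiplication
`(r#h)(s#g) = Σ r (h₍₁₎·s) # h₍₂₎ g`, unit `1#1`, `R`-coalgebra structure
`Δ(r#h) = Σ (r#h₍₁₎) ⊗_R (1#h₍₂₎)` and counit `ε(r#h) = r·ε_H(h)`, is an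
`R/k`-bialgebra: `R ↪ R#H` via `r ↦ r#1` is an injective algebra embedding, `Δ` and `ε`
are `R`-linear, `B` is an `R`-coalgebra, `Δ(1) = 1⊗1`, `Δ` is multiplicative on any
representations, `ε(1) = 1`, and `ε(bc) = ε(b·ε(c))`. -/
theorem smash_product_is_Rk_bialgebra
    (k R H : Type) [Field k] [CommRing R] [Algebra k R] [Ring H] [HopfAlgebra k H]
    -- `H` is cocommutative
    (hcocomm : ∀ h : H, (TensorProduct.comm k H H) (Coalgebra.comul h) = Coalgebra.comul h)
    -- `R` is a left `H`-module algebra via `act`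
    (act : H →ₗ[k] R →ₗ[k] R)
    (hact_one : ∀ r : R, act 1 r = r)
    (hact_mul : ∀ (g h : H) (r : R), act (g * h) r = act g (act h r))
    (hact_unit : ∀ h : H, act h 1 = Coalgebra.counit (R := k) h • (1 : R))
    (hact_alg : ∀ (h : H) (n : ℕ) (a b : Fin n → H),
      Coalgebra.comul (R := k) h = ∑ i, a i ⊗ₜ[k] b i →
      ∀ r s : R, act h (r * s) = ∑ i, act (a i) r * act (b i) s) :
    ∃ (mul : (R ⊗[k] H) →ₗ[k] (R ⊗[k] H) →ₗ[k] (R ⊗[k] H))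
      (delta : (R ⊗[k] H) →ₗ[R] (R ⊗[k] H) ⊗[R] (R ⊗[k] H))
      (eps : (R ⊗[k] H) →ₗ[R] R),
      -- defining formula for the smash multiplication
      (∀ (r s : R) (h g : H) (n : ℕ) (a b : Fin n → H),
        Coalgebra.comul (R := k) h = ∑ i, a i ⊗ₜ[k] b i →
        mul (r ⊗ₜ[k] h) (s ⊗ₜ[k] g) = ∑ i, (r * act (a i) s) ⊗ₜ[k] (b i * g)) ∧
      -- defining formula for the coproduct
      (∀ (r : R) (h : H) (n : ℕ) (a b : Fin n → H),
        Coalgebra.comul (R := k) h = ∑ i, a i ⊗ₜ[k] b i →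
        delta (r ⊗ₜ[k] h) = ∑ i, (r ⊗ₜ[k] a i) ⊗ₜ[R] ((1 : R) ⊗ₜ[k] b i)) ∧
      -- defining formula for the counit
      (∀ (r : R) (h : H), eps (r ⊗ₜ[k] h) = Coalgebra.counit (R := k) h • r) ∧
      -- `R # H` is an associative unital `k`-algebra
      (∀ x y z, mul (mul x y) z = mul x (mul y z)) ∧
      (∀ x, mul ((1 : R) ⊗ₜ[k] (1 : H)) x = x) ∧
      (∀ x, mul x ((1 : R) ⊗ₜ[k] (1 : H)) = x) ∧
      -- `R` embeds as a subalgebra via `r ↦ r # 1`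
      (Function.Injective fun r : R => r ⊗ₜ[k] (1 : H)) ∧
      (∀ r s : R, mul (r ⊗ₜ[k] (1 : H)) (s ⊗ₜ[k] (1 : H)) = (r * s) ⊗ₜ[k] (1 : H)) ∧
      -- the left `R`-module structure is left multiplication by the image of `R`
      (∀ (r : R) (x : R ⊗[k] H), r • x = mul (r ⊗ₜ[k] (1 : H)) x) ∧
      -- `R`-coalgebra axioms
      (∀ x, (TensorProduct.assoc R _ _ _)
          ((LinearMap.rTensor _ delta) (delta x)) = (LinearMap.lTensor _ delta) (delta x)) ∧
      (∀ x, (TensorProduct.lid R (R ⊗[k] H)) ((LinearMap.rTensor _ eps) (delta x)) = x) ∧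
      (∀ x, (TensorProduct.rid R (R ⊗[k] H)) ((LinearMap.lTensor _ eps) (delta x)) = x) ∧
      -- `Δ(1) = 1 ⊗ 1`
      (delta ((1 : R) ⊗ₜ[k] (1 : H)) =
        ((1 : R) ⊗ₜ[k] (1 : H)) ⊗ₜ[R] ((1 : R) ⊗ₜ[k] (1 : H))) ∧
      -- `Δ(bc) = Σ b₍₁₎c₍₁₎ ⊗ b₍₂₎c₍₂₎` for any representations of `Δ(b)`, `Δ(c)`
      (∀ (x y : R ⊗[k] H) (m n : ℕ)
          (x₁ x₂ : Fin m → R ⊗[k] H) (y₁ y₂ : Fin n → R ⊗[k] H),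
        delta x = ∑ i, x₁ i ⊗ₜ[R] x₂ i → delta y = ∑ j, y₁ j ⊗ₜ[R] y₂ j →
        delta (mul x y) = ∑ i, ∑ j, (mul (x₁ i) (y₁ j)) ⊗ₜ[R] (mul (x₂ i) (y₂ j))) ∧
      -- `ε(1) = 1`
      (eps ((1 : R) ⊗ₜ[k] (1 : H)) = 1) ∧
      -- `ε(bc) = ε(b ε(c))`
      (∀ x y, eps (mul x y) = eps (mul x ((eps y) ⊗ₜ[k] (1 : H)))) := by
  classical
  choose n a b hab using fun h : H => SmashAux.exists_fin (Coalgebra.comul (R := k) h)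
  have hmul : ∀ (r s : R) (h g : H), SmashAux.mul act (r ⊗ₜ h) (s ⊗ₜ g) =
      ∑ i, (r * act (a h i) s) ⊗ₜ[k] (b h i * g) := by
    intro r s h g
    rw [SmashAux.mul_tmul, hab]; simp
  have hdel : ∀ (r : R) (h : H) (n : ℕ) (a b : Fin n → H),
      Coalgebra.comul (R := k) h = ∑ i, a i ⊗ₜ[k] b i →
      Coalgebra.comul (R := R) (r ⊗ₜ[k] h) = ∑ i, (r ⊗ₜ[k] a i) ⊗ₜ[R] ((1 : R) ⊗ₜ[k] b i) := by
    intro r h n a b hh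
    rw [TensorProduct.comul_tmul, hh, CommSemiring.comul_apply, tmul_sum, map_sum]
    refine Finset.sum_congr rfl fun i _ => ?_
    rw [AlgebraTensorModule.tensorTensorTensorComm_tmul]
    have : ∀ c : H, r ⊗ₜ[k] c = r • ((1 : R) ⊗ₜ[k] c) := fun c => by simp [smul_tmul']
    rw [this, this, smul_tmul]
  have heps : ∀ (r : R) (h : H), Coalgebra.counit (R := R) (r ⊗ₜ[k] h)
      = Coalgebra.counit (R := k) h • r := by
    intro r h
    rw [TensorProduct.counit_tmul, CommSemiring.counit_apply]
  have hcu : ∀ h : H, ∑ i, Coalgebra.counit (R := k) (a h i) • b h i = h := by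
    intro h
    have := congrArg (TensorProduct.lid k H) (Coalgebra.rTensor_counit_comul (R := k) h)
    rw [hab] at this
    simpa using this
  have hcu' : ∀ h : H, ∑ i, Coalgebra.counit (R := k) (b h i) • a h i = h := by
    intro h
    have := congrArg (TensorProduct.rid k H) (Coalgebra.lTensor_counit_comul (R := k) h)
    rw [hab] at this
    simpa using this
  have hassoc : ∀ x y z, SmashAux.mul act (SmashAux.mul act x y) z
      = SmashAux.mul act x (SmashAux.mul act y z) := by
    intro x y z
    induction x using TensorProduct.induction_on with
    | zero => simp
    | add x x' hx hy => simp only [map_add, LinearMap.add_apply, hx, hy]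
    | tmul r h =>
    induction y using TensorProduct.induction_on with
    | zero => simp
    | add x x' hx hy => simp only [map_add, LinearMap.add_apply, hx, hy]
    | tmul s g =>
    induction z using TensorProduct.induction_on with
    | zero => simp
    | add x x' hx hy => simp only [map_add, hx, hy]
    | tmul t l =>
    have key := fun j => SmashAux.coassoc3 hab
      (fun x y z => (r * (act x s * act y (act (a g j) t))) ⊗ₜ[k] (z * (b g j * l)))
      (fun _ _ => ⟨by simp [add_mul, mul_add, add_tmul], by simp [smul_tmul']⟩)
      (fun _ _ => ⟨by simp [add_mul, mul_add, add_tmul], by simp [smul_tmul']⟩)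
      (fun _ _ => ⟨by simp [add_mul, tmul_add], by simp⟩) h
    have e1 : SmashAux.mul act (SmashAux.mul act (r ⊗ₜ h) (s ⊗ₜ g)) (t ⊗ₜ l) =
        ∑ j, ∑ i, ∑ i', (r * (act (a h i) s * act (a (b h i) i') (act (a g j) t)))
          ⊗ₜ[k] (b (b h i) i' * (b g j * l)) := by
      rw [hmul, map_sum, LinearMap.sum_apply, Finset.sum_comm]
      refine Finset.sum_congr rfl fun i _ => ?_
      rw [SmashAux.mul_tmul, Bialgebra.comul_mul, hab (b h i), hab g, Finset.sum_mul_sum,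
        map_sum, Finset.sum_comm]
      simp [hact_mul, mul_assoc]
    have e2 : SmashAux.mul act (r ⊗ₜ h) (SmashAux.mul act (s ⊗ₜ g) (t ⊗ₜ l)) =
        ∑ j, ∑ i, ∑ i', (r * (act (a (a h i) i') s * act (b (a h i) i') (act (a g j) t)))
          ⊗ₜ[k] (b h i * (b g j * l)) := by
      rw [hmul, map_sum]
      refine Finset.sum_congr rfl fun j _ => ?_
      rw [hmul]
      refine Finset.sum_congr rfl fun i _ => ?_
      rw [hact_alg _ _ _ _ (hab (a h i)), Finset.mul_sum, sum_tmul]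
    rw [e1, e2]
    exact Finset.sum_congr rfl fun j _ => (key j).symm
  have hR : ∀ (r : R) (x : R ⊗[k] H), r • x = SmashAux.mul act (r ⊗ₜ[k] (1 : H)) x := by
    intro r x
    induction x using TensorProduct.induction_on with
    | zero => simp
    | add x x' hx hy => simp only [smul_add, map_add, hx, hy]
    | tmul s g =>
      rw [SmashAux.mul_tmul, Bialgebra.comul_one, Algebra.TensorProduct.one_def]
      simp [hact_one, smul_tmul']
  have h11 : ∀ (r : R) (h g : H), SmashAux.mul act (r ⊗ₜ h) (1 ⊗ₜ g) = r ⊗ₜ (h * g) := by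
    intro r h g
    rw [hmul]
    conv_rhs => rw [← hcu h]
    simp [hact_unit, Finset.sum_mul, tmul_sum, smul_tmul']
  have hbal : ∀ (x y z : R ⊗[k] H) (r : R),
      TensorProduct.map (SmashAux.mulR act (r • y)) (SmashAux.mulR act z)
        (Coalgebra.comul (R := R) x) =
      TensorProduct.map (SmashAux.mulR act y) (SmashAux.mulR act (r • z))
        (Coalgebra.comul (R := R) x) := by
    intro x y z r
    induction x using TensorProduct.induction_on with
    | zero => simp
    | add x x' hx hy => simp only [map_add, hx, hy]
    | tmul s h =>
    have hs : ∀ (c : H) (y : R ⊗[k] H), SmashAux.mul act (1 ⊗ₜ c) (r • y) =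
        ∑ i, act (a c i) r • SmashAux.mul act (1 ⊗ₜ b c i) y := by
      intro c y
      rw [hR, ← hassoc, hmul, map_sum, LinearMap.sum_apply]
      refine Finset.sum_congr rfl fun i _ => ?_
      rw [← SmashAux.mul_smul_left, smul_tmul']
      simp
    have hl : s ⊗ₜ[k] h = s • ((1 : R) ⊗ₜ[k] h) := by simp [smul_tmul']
    rw [hl]
    simp only [map_smul]
    congr 1
    rw [hdel 1 h _ _ _ (hab h)]
    simp only [map_sum, TensorProduct.map_tmul, SmashAux.mulR_apply, hs, sum_tmul, tmul_sum]
    let f : H → H → H → (R ⊗[k] H) ⊗[R] (R ⊗[k] H) := fun x y' z' =>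
      act x r • (SmashAux.mul act (1 ⊗ₜ y') y ⊗ₜ[R] SmashAux.mul act (1 ⊗ₜ z') z)
    have f1 : ∀ y' z', IsLinearMap k (fun x => f x y' z') := fun _ _ =>
      ⟨by simp [f, add_smul], by simp [f, smul_assoc]⟩
    have f2 : ∀ x z', IsLinearMap k (fun y' => f x y' z') := fun _ _ =>
      ⟨by simp [f, tmul_add, add_tmul], fun c y' => by
        simp only [f, tmul_smul, map_smul, LinearMap.smul_apply, ← smul_tmul']
        rw [smul_comm]⟩
    have f3 : ∀ x y', IsLinearMap k (fun z' => f x y' z') := fun _ _ =>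
      ⟨by simp [f, tmul_add], fun c y' => by
        simp only [f, tmul_smul, map_smul, LinearMap.smul_apply]
        rw [smul_comm]⟩
    have k1 := SmashAux.coassoc3 hab (fun x y z => f y x z) f2 f1 (fun x y => f3 y x) h
    calc _ = ∑ i, ∑ j, f (a (a h i) j) (b (a h i) j) (b h i) := by
          simp only [f, smul_tmul']
      _ = ∑ i, ∑ j, f (b (a h i) j) (a (a h i) j) (b h i) := by
          refine Finset.sum_congr rfl fun i _ => ?_
          let G : H →ₗ[k] H →ₗ[k] (R ⊗[k] H) ⊗[R] (R ⊗[k] H) :=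
            LinearMap.mk₂ k (fun x y => f x y (b h i))
              (fun x x' y => (f1 _ _).map_add x x') (fun c x y => (f1 _ _).map_smul c x)
              (fun x y y' => (f2 _ _).map_add y y') (fun c x y => (f2 _ _).map_smul c y)
          have := congrArg (TensorProduct.lift G) (hcocomm (a h i))
          rw [hab (a h i)] at this
          simpa [G] using this.symm
      _ = _ := k1
      _ = _ := by simp only [f, tmul_smul]
  refine ⟨SmashAux.mul act, Coalgebra.comul, Coalgebra.counit, ?_, hdel, heps, hassoc, ?_, ?_, ?_,
    ?_, hR, Coalgebra.coassoc_apply, ?_, ?_, ?_, ?_, ?_, ?_⟩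
  · intro r s h g n a b hh
    rw [SmashAux.mul_tmul, hh]; simp
  · intro x
    rw [← hR, one_smul]
  · intro x
    induction x using TensorProduct.induction_on with
    | zero => simp
    | add x x' hx hy => simp only [map_add, LinearMap.add_apply, hx, hy]
    | tmul s g => rw [h11, mul_one]
  · intro r s hrs
    have := congrArg (Coalgebra.counit (R := R)) hrs
    simpa [heps] using this
  · intro r s
    rw [← hR, smul_tmul', smul_eq_mul]
  · intro x
    rw [Coalgebra.rTensor_counit_comul]; simp
  · intro x
    rw [Coalgebra.lTensor_counit_comul]; simp
  · rw [hdel 1 1 1 (fun _ => 1) (fun _ => 1)]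
    · simp
    · rw [Bialgebra.comul_one, Algebra.TensorProduct.one_def]; simp
  · intro x y m n' x₁ x₂ y₁ y₂ hx hy
    let F : ∀ x : R ⊗[k] H, (R ⊗[k] H) ⊗[R] (R ⊗[k] H) →+ (R ⊗[k] H) ⊗[R] (R ⊗[k] H) := fun x =>
      TensorProduct.liftAddHom
        (AddMonoidHom.mk' (fun y => AddMonoidHom.mk' (fun z =>
            TensorProduct.map (SmashAux.mulR act y) (SmashAux.mulR act z)
              (Coalgebra.comul (R := R) x))
            (fun z z' => by
              have : SmashAux.mulR act (z + z') = SmashAux.mulR act z + SmashAux.mulR act z' := by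
                ext; simp
              rw [this, TensorProduct.map_add_right]; rfl))
          (fun y y' => by
            ext z
            have : SmashAux.mulR act (y + y') = SmashAux.mulR act y + SmashAux.mulR act y' := by
              ext; simp
            simp [this, TensorProduct.map_add_left]))
        (fun r y z => hbal x y z r)
    have hF : ∀ x y z, F x (y ⊗ₜ z) = TensorProduct.map (SmashAux.mulR act y)
        (SmashAux.mulR act z) (Coalgebra.comul (R := R) x) := fun x y z => rfl
    have hFadd : ∀ x x' w, F (x + x') w = F x w + F x' w := by
      intro x x' w
      induction w using TensorProduct.induction_on with
      | zero => simp
      | add w w' h1 h2 => simp only [map_add, h1, h2]; abel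
      | tmul y z => simp only [hF, map_add]
    have main : ∀ x y, Coalgebra.comul (R := R) (SmashAux.mul act x y)
        = F x (Coalgebra.comul (R := R) y) := by
      intro x y
      induction x using TensorProduct.induction_on with
      | zero =>
        have : ∀ w, F 0 w = 0 := fun w => by simpa using hFadd 0 0 w
        simp [this]
      | add x x' hx hy => simp only [map_add, LinearMap.add_apply, hx, hy, hFadd]
      | tmul r h =>
      induction y using TensorProduct.induction_on with
      | zero => simp
      | add x x' hx hy => simp only [map_add, hx, hy]
      | tmul s g =>
      have hd2 : ∀ (t : R) (c g : H), Coalgebra.comul (R := R) (t ⊗ₜ[k] (c * g)) =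
          ∑ i, ∑ j, (t ⊗ₜ[k] (a c i * a g j)) ⊗ₜ[R] ((1 : R) ⊗ₜ[k] (b c i * b g j)) := by
        intro t c g
        have e : Coalgebra.comul (R := k) (c * g) = ∑ p : Fin (n c * n g),
            (a c (finProdFinEquiv.symm p).1 * a g (finProdFinEquiv.symm p).2) ⊗ₜ[k]
            (b c (finProdFinEquiv.symm p).1 * b g (finProdFinEquiv.symm p).2) := by
          rw [Bialgebra.comul_mul, hab c, hab g, Finset.sum_mul_sum, ← Fintype.sum_prod_type',
            ← Equiv.sum_comp finProdFinEquiv.symm]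
          simp
        rw [hdel _ _ _ _ _ e, ← Fintype.sum_prod_type', ← Equiv.sum_comp finProdFinEquiv.symm]
      rw [hmul, hdel s g _ _ _ (hab g), map_sum, map_sum]
      simp only [hd2, hF, hdel r h _ _ _ (hab h), map_sum, TensorProduct.map_tmul,
        SmashAux.mulR_apply, h11, hmul r s, sum_tmul]
      have key := fun j => SmashAux.coassoc3 hab
        (fun x y z => ((r * act x s) ⊗ₜ[k] (y * a g j)) ⊗ₜ[R] ((1 : R) ⊗ₜ[k] (z * b g j)))
        (fun _ _ => ⟨by simp [mul_add, add_tmul], by simp [← smul_tmul']⟩)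
        (fun _ _ => ⟨by simp [add_mul, add_tmul, tmul_add], by simp [← smul_tmul']⟩)
        (fun _ _ => ⟨by simp [add_mul, tmul_add], by simp⟩) h
      rw [Finset.sum_congr rfl fun j _ => key j, Finset.sum_comm]
      refine Finset.sum_congr rfl fun i _ => ?_
      rw [Finset.sum_comm]
    rw [main, hy, map_sum, Finset.sum_comm]
    refine Finset.sum_congr rfl fun j _ => ?_
    rw [hF, hx, map_sum]
    rfl
  · rw [heps]; simp
  · intro x y
    have h1 : ∀ (r s : R) (h g : H), Coalgebra.counit (R := R) (SmashAux.mul act (r ⊗ₜ h) (s ⊗ₜ g))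
        = Coalgebra.counit (R := k) g • (r * act h s) := by
      intro r s h g
      rw [hmul, map_sum]
      conv_rhs => rw [← hcu' h]
      simp only [heps, Bialgebra.counit_mul, map_sum, LinearMap.sum_apply, Finset.mul_sum,
        Finset.smul_sum, map_smul, LinearMap.smul_apply, mul_smul_comm, smul_smul]
      simp only [mul_comm]
    induction x using TensorProduct.induction_on with
    | zero => simp
    | add x x' hx hy => simp only [map_add, LinearMap.add_apply, hx, hy]
    | tmul r h =>
    induction y using TensorProduct.induction_on with
    | zero => simp
    | add x x' hx hy => simp only [map_add, add_tmul, hx, hy]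
    | tmul s g => rw [h1, heps, h1]; simp
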